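/- arXiv:2502.01554 — 3 statements merged into one kernel-verified Lean document; each statement's English description precedes it below -/
import Mathlib

section
/- Let Ω ⊆ ℝ^d (d ≥ 1) be an open set, let ψ : Ω → ℝ be upper semicontinuous, locally integrable, and satisfy the sub-mean value inequality on balls, and let φ : Ω → ℝ be continuous. Let A ⊆ Ω be a Lebesgue measurable set such that ψ(y) ≤ φ(y) for Lebesgue-almost every y ∈ A. Then ψ(x) ≤ φ(x) for every point x ∈ Ω that is a Lebesgue density point of A. -/
open MeasureTheory Filter

/-- If `ψ` is upper semicontinuous, locally integrable and satisfies the sub-mean value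
inequality on balls on an open set `Ω ⊆ ℝ^d`, `φ` is continuous on `Ω`, and `ψ ≤ φ`
almost everywhere on a measurable set `A ⊆ Ω`, then `ψ ≤ φ` at every Lebesgue density
point of `A` lying in `Ω`. -/
theorem le_at_density_point (d : ℕ) (hd : 1 ≤ d)
    (Ω : Set (EuclideanSpace ℝ (Fin d))) (hΩ : IsOpen Ω)
    (ψ φ : EuclideanSpace ℝ (Fin d) → ℝ)
    (hψ_usc : UpperSemicontinuousOn ψ Ω)
    (hψ_loc : LocallyIntegrableOn ψ Ω volume)
    (hψ_submean : ∀ x ∈ Ω, ∀ r > (0 : ℝ), Metric.closedBall x r ⊆ Ω →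
      ψ x ≤ (volume (Metric.ball x r)).toReal⁻¹ * ∫ y in Metric.ball x r, ψ y)
    (hφ : ContinuousOn φ Ω)
    (A : Set (EuclideanSpace ℝ (Fin d))) (hA : MeasurableSet A) (hAΩ : A ⊆ Ω)
    (hle : ∀ᵐ y ∂(volume.restrict A), ψ y ≤ φ y)
    (x : EuclideanSpace ℝ (Fin d)) (hx : x ∈ Ω)
    (hdens : Tendsto (fun r : ℝ => volume (A ∩ Metric.ball x r) / volume (Metric.ball x r))
      (nhdsWithin 0 (Set.Ioi 0)) (nhds 1)) :
    ψ x ≤ φ x := by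
  by_contra hcon
  push Not at hcon
  obtain ⟨δ, hδ⟩ : ∃ δ, δ = ψ x - φ x := ⟨_, rfl⟩
  have hδ0 : 0 < δ := by linarith
  have h1 : ∀ᶠ y in nhds x, ψ y < ψ x + δ / 4 := by
    have := hψ_usc x hx (ψ x + δ / 4) (by linarith)
    rwa [hΩ.nhdsWithin_eq hx] at this
  have h2 : ∀ᶠ y in nhds x, φ y < φ x + δ / 2 :=
    (hφ.continuousAt (hΩ.mem_nhds hx)).eventually_lt_const (by linarith)
  have h3 : ∀ᶠ y in nhds x, y ∈ Ω := hΩ.mem_nhds hx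
  obtain ⟨R, hR, hball⟩ := Metric.eventually_nhds_iff_ball.1 (h1.and (h2.and h3))
  have h4 : ∀ᶠ r : ℝ in nhdsWithin 0 (Set.Ioi 0),
      (2⁻¹ : ENNReal) < volume (A ∩ Metric.ball x r) / volume (Metric.ball x r) :=
    hdens.eventually_const_lt (by simp)
  have h5 : ∀ᶠ r : ℝ in nhdsWithin 0 (Set.Ioi 0), r < R :=
    nhdsWithin_le_nhds (Iio_mem_nhds hR)
  obtain ⟨r, ⟨hr4, hrR⟩, hr0⟩ := ((h4.and h5).and self_mem_nhdsWithin).exists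
  have hr0 : 0 < r := hr0
  have hsub : Metric.closedBall x r ⊆ Metric.ball x R := Metric.closedBall_subset_ball hrR
  have hcb : Metric.closedBall x r ⊆ Ω := fun y hy => (hball y (hsub hy)).2.2
  have hm := hψ_submean x hx r hr0 hcb
  have hVpos : 0 < volume (Metric.ball x r) := Metric.measure_ball_pos _ _ hr0
  have hVfin : volume (Metric.ball x r) ≠ ⊤ := measure_ball_lt_top.ne
  have hV : 0 < (volume (Metric.ball x r)).toReal := ENNReal.toReal_pos hVpos.ne' hVfin
  have hint : IntegrableOn ψ (Metric.ball x r) volume :=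
    (hψ_loc.integrableOn_compact_subset hcb (isCompact_closedBall x r)).mono_set
      Metric.ball_subset_closedBall
  have hAV : (volume (Metric.ball x r)).toReal / 2 < (volume (A ∩ Metric.ball x r)).toReal := by
    have hfin : volume (A ∩ Metric.ball x r) / volume (Metric.ball x r) ≠ ⊤ :=
      ENNReal.div_ne_top (measure_ne_top_of_subset Set.inter_subset_right hVfin) hVpos.ne'
    have := ENNReal.toReal_strict_mono hfin hr4
    rw [ENNReal.toReal_div, lt_div_iff₀ hV] at this
    simp at this
    linarith
  have hc : IntegrableOn (fun _ : EuclideanSpace ℝ (Fin d) => ψ x + δ / 4)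
      (Metric.ball x r) volume := integrableOn_const hVfin
  have hi : IntegrableOn (A.indicator (fun _ => 3 * δ / 4)) (Metric.ball x r) volume :=
    IntegrableOn.indicator (integrableOn_const hVfin) hA
  have hle' : ∀ᵐ y, y ∈ A → ψ y ≤ φ y := (ae_restrict_iff' hA).1 hle
  have hbound : ∫ y in Metric.ball x r, ψ y ≤
      ∫ y in Metric.ball x r, ((ψ x + δ / 4) - A.indicator (fun _ => 3 * δ / 4) y) := by
    refine setIntegral_mono_on_ae hint (hc.sub hi) measurableSet_ball ?_
    filter_upwards [hle'] with y hy hyb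
    obtain ⟨ha, hb, -⟩ := hball y (hsub (Metric.ball_subset_closedBall hyb))
    by_cases hyA : y ∈ A
    · rw [Set.indicator_of_mem hyA]
      have := hy hyA
      linarith
    · rw [Set.indicator_of_notMem hyA]
      linarith
  rw [integral_sub hc hi, setIntegral_const, integral_indicator_const _ hA,
    measureReal_restrict_apply hA] at hbound
  simp only [Measure.real, smul_eq_mul] at hbound
  rw [inv_mul_eq_div, le_div_iff₀ hV] at hm
  nlinarith
end

section
/- Let Ω ⊆ ℝ^d (d ≥ 1) be an open set, let ψ : Ω → ℝ be upper semicontinuous, locally integrable, and satisfy the sub-mean value inequality on balls, and let φ : Ω → ℝ be continuous. Let A ⊆ Ω be a Lebesgue measurable set of positive Lebesgue measure. Then, as elements of the extended reals, the essential supremum of ψ − φ over A with respect to Lebesgue measure equals the supremum of ψ(x) − φ(x) over all points x ∈ Ω that are Lebesgue density points of A. -/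
open MeasureTheory Filter

/-- If `ψ` is upper semicontinuous, locally integrable and satisfies the sub-mean value
inequality on balls on an open set `Ω ⊆ ℝ^d`, `φ` is continuous on `Ω`, and `A ⊆ Ω` is a
measurable set of positive Lebesgue measure, then (in the extended reals) the essential
supremum of `ψ - φ` over `A` equals the supremum of `ψ - φ` over the Lebesgue density
points of `A` lying in `Ω`. -/
theorem essSup_eq_sup_density_points (d : ℕ) (hd : 1 ≤ d)
    (Ω : Set (EuclideanSpace ℝ (Fin d))) (hΩ : IsOpen Ω)
    (ψ φ : EuclideanSpace ℝ (Fin d) → ℝ)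
    (hψ_usc : UpperSemicontinuousOn ψ Ω)
    (hψ_loc : LocallyIntegrableOn ψ Ω volume)
    (hψ_submean : ∀ x ∈ Ω, ∀ r > (0 : ℝ), Metric.closedBall x r ⊆ Ω →
      ψ x ≤ (volume (Metric.ball x r)).toReal⁻¹ * ∫ y in Metric.ball x r, ψ y)
    (hφ : ContinuousOn φ Ω)
    (A : Set (EuclideanSpace ℝ (Fin d))) (hA : MeasurableSet A) (hAΩ : A ⊆ Ω)
    (hApos : 0 < volume A) :
    essSup (fun y => ((ψ y - φ y : ℝ) : EReal)) (volume.restrict A)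
      =
    ⨆ (x : EuclideanSpace ℝ (Fin d)) (_ : x ∈ Ω ∧
        Tendsto (fun r : ℝ => volume (A ∩ Metric.ball x r) / volume (Metric.ball x r))
          (nhdsWithin 0 (Set.Ioi 0)) (nhds 1)),
      ((ψ x - φ x : ℝ) : EReal) := by
  apply le_antisymm
  · refine essSup_le_of_ae_le _ ?_
    have h1 := Besicovitch.ae_tendsto_measure_inter_div (volume : Measure (EuclideanSpace ℝ (Fin d))) A
    filter_upwards [h1, ae_restrict_mem hA] with x hx hxA
    refine le_iSup₂_of_le x ⟨hAΩ hxA, ?_⟩ le_rfl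
    refine hx.congr' ?_
    filter_upwards [self_mem_nhdsWithin] with r hr
    have hr0 : r ≠ 0 := ne_of_gt hr
    have hs : (Metric.closedBall x r : Set _) =ᵐ[volume] Metric.ball x r := by
      rw [← Metric.ball_union_sphere]
      exact union_ae_eq_left_of_ae_eq_empty
        (ae_eq_empty.2 (Measure.addHaar_sphere_of_ne_zero volume x hr0))
    rw [measure_congr hs, measure_congr ((ae_eq_refl A).inter hs)]
  · refine iSup₂_le ?_
    rintro x ⟨hxΩ, hx⟩
    by_contra! hlt
    obtain ⟨c, hc1, hc2⟩ := EReal.lt_iff_exists_real_btwn.1 hlt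
    have hc2' : c < ψ x - φ x := by exact_mod_cast hc2
    have hae : ∀ᵐ y ∂volume.restrict A, ψ y - φ y < c := by
      filter_upwards [ae_lt_of_essSup_lt hc1] with y hy
      exact_mod_cast hy
    set δ := ψ x - φ x - c with hδ
    have hδ0 : 0 < δ := by linarith
    have hΩx : Ω ∈ nhds x := hΩ.mem_nhds hxΩ
    have e1 : ∀ᶠ y in nhds x, ψ y < ψ x + δ / 2 := by
      have := hψ_usc x hxΩ (ψ x + δ / 2) (by linarith)
      rwa [nhdsWithin_eq_nhds.2 hΩx] at this
    have e2 : ∀ᶠ y in nhds x, φ y < φ x + δ / 2 :=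
      (hφ.continuousAt hΩx).eventually (gt_mem_nhds (by linarith))
    obtain ⟨R, hR0, hR⟩ := Metric.nhds_basis_closedBall.mem_iff.1
      (inter_mem hΩx (inter_mem e1 e2))
    have e3 : ∀ᶠ r : ℝ in nhdsWithin 0 (Set.Ioi 0),
        (1 / 2 : ENNReal) < volume (A ∩ Metric.ball x r) / volume (Metric.ball x r) :=
      hx.eventually (lt_mem_nhds (by
        rw [one_div]; exact ENNReal.inv_lt_one.2 (by norm_num)))
    obtain ⟨r, hr3, hr0, hrR⟩ := (e3.and (Ioo_mem_nhdsGT hR0)).exists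
    have hsub : Metric.closedBall x r ⊆ Metric.closedBall x R :=
      Metric.closedBall_subset_closedBall hrR.le
    have hΩr : Metric.closedBall x r ⊆ Ω := fun y hy => (hR (hsub hy)).1
    have hm := hψ_submean x hxΩ r hr0 hΩr
    have hBpos : 0 < volume.real (Metric.ball x r) :=
      ENNReal.toReal_pos (Metric.measure_ball_pos volume x hr0).ne' measure_ball_lt_top.ne
    have hdens : volume.real (Metric.ball x r) < 2 * volume.real (A ∩ Metric.ball x r) := by
      have hfin : volume (A ∩ Metric.ball x r) ≠ ⊤ :=
        measure_ne_top_of_subset Set.inter_subset_right measure_ball_lt_top.ne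
      have := (ENNReal.toReal_lt_toReal (by simp)
        (ENNReal.div_lt_top hfin (Metric.measure_ball_pos volume x hr0).ne').ne).2 hr3
      rw [ENNReal.toReal_div, ENNReal.toReal_div] at this
      change _ < volume.real (A ∩ Metric.ball x r) / volume.real (Metric.ball x r) at this
      rw [lt_div_iff₀ hBpos] at this
      norm_num at this
      linarith
    have hint : IntegrableOn ψ (Metric.ball x r) volume :=
      (hψ_loc.integrableOn_compact_subset hΩr (isCompact_closedBall x r)).mono_set
        Metric.ball_subset_closedBall
    have hi1 : IntegrableOn (fun _ : EuclideanSpace ℝ (Fin d) => ψ x + δ / 2)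
        (Metric.ball x r) volume := integrableOn_const measure_ball_lt_top.ne
    have hi2 : IntegrableOn (A.indicator (fun _ : EuclideanSpace ℝ (Fin d) => δ))
        (Metric.ball x r) volume :=
      (integrableOn_const (C := δ) measure_ball_lt_top.ne).indicator hA
    have hle : ∫ y in Metric.ball x r, ψ y ≤
        ∫ y in Metric.ball x r, ((ψ x + δ / 2) - A.indicator (fun _ => δ) y) := by
      refine setIntegral_mono_ae_restrict hint (hi1.sub hi2) ?_
      filter_upwards [ae_restrict_mem measurableSet_ball,
        ae_restrict_of_ae ((ae_restrict_iff' hA).1 hae)] with y hy hyA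
      obtain ⟨-, h1, h2⟩ := hR (hsub (Metric.ball_subset_closedBall hy))
      simp only [Set.mem_ofPred_eq] at h1 h2
      by_cases hmem : y ∈ A
      · have := hyA hmem
        simp only [Set.indicator_of_mem hmem]
        linarith
      · simp only [Set.indicator_of_notMem hmem]
        linarith
    rw [integral_sub hi1 hi2, setIntegral_const, integral_indicator hA,
      Measure.restrict_restrict hA, setIntegral_const, smul_eq_mul, smul_eq_mul] at hle
    change _ ≤ (volume.real (Metric.ball x r))⁻¹ * _ at hm
    rw [inv_mul_eq_div, le_div_iff₀ hBpos] at hm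
    nlinarith
end

section
/- Fix p ∈ [1, ∞). Let (n_k)_{k∈ℕ} be a sequence of positive integers and for each k let A_k, B_k ∈ M_{n_k}(ℂ) be positive definite Hermitian matrices. If (1/k)·d_p(A_k, B_k) → 0 as k → ∞, then (1/k)·‖log A_k − log B_k‖_p → 0 as k → ∞; that is, for every ε > 0 there is k₀ ∈ ℕ such that ‖log A_k − log B_k‖_p ≤ ε·k for all k ≥ k₀. -/
open Matrix Filter
open scoped ComplexOrder

/-- The Hermitian logarithm of a (positive definite Hermitian) matrix, via the
continuous functional calculus. -/
noncomputable def matLog {n : ℕ} (A : Matrix (Fin n) (Fin n) ℂ) : Matrix (Fin n) (Fin n) ℂ :=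
  cfc Real.log A

/-- The inverse square root `A^{-1/2}` of a (positive definite Hermitian) matrix, via the
continuous functional calculus. -/
noncomputable def matInvSqrt {n : ℕ} (A : Matrix (Fin n) (Fin n) ℂ) :
    Matrix (Fin n) (Fin n) ℂ :=
  cfc (fun t : ℝ => (Real.sqrt t)⁻¹) A

/-- The normalized Schatten `p`-norm `‖X‖_p = ((1/n) tr((X^*X)^{p/2}))^{1/p}`. -/
noncomputable def schattenNorm {n : ℕ} (p : ℝ) (X : Matrix (Fin n) (Fin n) ℂ) : ℝ :=
  (((1 : ℝ) / n) * (Matrix.trace (cfc (fun t : ℝ => t ^ (p / 2)) (Xᴴ * X))).re) ^ (1 / p)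

/-- The distance `d_p(A, B) = ((1/n) Σᵢ |log μᵢ|^p)^{1/p}`, where `μ₁, …, μ_n` are the
eigenvalues of `A^{-1/2} B A^{-1/2}`; equivalently, the normalized Schatten `p`-norm of
`log (A^{-1/2} B A^{-1/2})`. -/
noncomputable def dMab {n : ℕ} (p : ℝ) (A B : Matrix (Fin n) (Fin n) ℂ) : ℝ :=
  schattenNorm p (matLog (matInvSqrt A * B * matInvSqrt A))

open scoped MatrixOrder

namespace SLog

variable {n : ℕ}

lemma contS (f : ℝ → ℝ) (A : Matrix (Fin n) (Fin n) ℂ) : ContinuousOn f (spectrum ℝ A) :=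
  (A.finite_real_spectrum).continuousOn f

lemma contI (f g : ℝ → ℝ) (A : Matrix (Fin n) (Fin n) ℂ) : ContinuousOn f (g '' spectrum ℝ A) :=
  ((A.finite_real_spectrum).image g).continuousOn f

lemma trace_cfc {A : Matrix (Fin n) (Fin n) ℂ} (hA : A.IsHermitian) (f : ℝ → ℝ) :
    (cfc f A).trace = ((∑ i, f (hA.eigenvalues i) : ℝ) : ℂ) := by
  rw [hA.cfc_eq f, IsHermitian.cfc, Unitary.conjStarAlgAut_apply, trace_mul_comm, ← mul_assoc]
  simp [trace]

lemma det_cfc {A : Matrix (Fin n) (Fin n) ℂ} (hA : A.IsHermitian) (f : ℝ → ℝ) :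
    (cfc f A).det = ((∏ i, f (hA.eigenvalues i) : ℝ) : ℂ) := by
  rw [hA.cfc_eq f, IsHermitian.cfc, Unitary.conjStarAlgAut_apply, det_mul_comm, ← mul_assoc]
  simp

lemma trace_log {A : Matrix (Fin n) (Fin n) ℂ} (hA : A.PosDef) :
    (matLog A).trace = ((Real.log A.det.re : ℝ) : ℂ) := by
  have h : A.det.re = ∏ i, hA.isHermitian.eigenvalues i := by
    rw [hA.isHermitian.det_eq_prod_eigenvalues]
    norm_cast
  rw [matLog, trace_cfc hA.isHermitian, h, Real.log_prod]
  intro i _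
  exact (hA.eigenvalues_pos i).ne'

lemma trace_schatten {M : Matrix (Fin n) (Fin n) ℂ} (hM : M.IsHermitian) (g : ℝ → ℝ) (p : ℝ) :
    schattenNorm p (cfc g M) =
      ((1 : ℝ) / n * ∑ i, |g (hM.eigenvalues i)| ^ p) ^ (1 / p) := by
  have hs : IsSelfAdjoint M := hM
  have h1 : (cfc g M)ᴴ * cfc g M = cfc (fun t => g t * g t) M := by
    rw [cfc_mul g g M (contS _ _) (contS _ _)]
    congr 1
    exact (cfc_predicate g M : IsSelfAdjoint (cfc g M))
  rw [schattenNorm, h1, ← cfc_comp' (fun t : ℝ => t ^ (p / 2)) (fun t => g t * g t) M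
    (contI _ _ _) (contS _ _) hs, trace_cfc hM, Complex.ofReal_re]
  congr 2
  refine Finset.sum_congr rfl fun i _ => ?_
  rw [← abs_mul_abs_self, ← pow_two, ← Real.rpow_natCast, ← Real.rpow_mul (abs_nonneg _)]
  congr 1
  push_cast
  ring

lemma matLog_le {A B : Matrix (Fin n) (Fin n) ℂ} (hA : A.PosDef) (h : A ≤ B) :
    matLog A ≤ matLog B := by
  open scoped Matrix.Norms.L2Operator in
  exact CFC.log_le_log (A := Matrix (Fin n) (Fin n) ℂ) h (isStrictlyPositive_iff_posDef.2 hA)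

lemma matLog_smul {A : Matrix (Fin n) (Fin n) ℂ} (hA : A.PosDef) (c : ℝ) :
    matLog (Real.exp c • A) = c • (1 : Matrix (Fin n) (Fin n) ℂ) + matLog A := by
  have h : cfc Real.log (Real.exp c • A) =
      algebraMap ℝ _ (Real.log (Real.exp c)) + cfc Real.log A := by
    open scoped Matrix.Norms.L2Operator in
    exact CFC.log_smul' (A := Matrix (Fin n) (Fin n) ℂ) A (Real.exp_pos c)
      (isStrictlyPositive_iff_posDef.2 hA)
  rw [Real.log_exp, Algebra.algebraMap_eq_smul_one] at h
  exact h

lemma hinge_trace {H G : Matrix (Fin n) (Fin n) ℂ} (hH : H.IsHermitian) (c : ℝ)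
    (hG : 0 ≤ G) (hHG : H - c • (1 : Matrix (Fin n) (Fin n) ℂ) ≤ G) :
    ∑ i, max (hH.eigenvalues i - c) 0 ≤ G.trace.re := by
  set U : Matrix (Fin n) (Fin n) ℂ := hH.eigenvectorUnitary.1 with hU
  have hUU : Uᴴ * U = 1 := Unitary.coe_star_mul_self hH.eigenvectorUnitary
  have hUU' : U * Uᴴ = 1 := Unitary.coe_mul_star_self hH.eigenvectorUnitary
  have hd : Uᴴ * H * U = diagonal (fun i => (hH.eigenvalues i : ℂ)) := by
    have := hH.conjStarAlgAut_star_eigenvectorUnitary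
    rw [Unitary.conjStarAlgAut_apply] at this
    simp [star_eq_conjTranspose] at this
    exact this
  have ht : G.trace = (Uᴴ * G * U).trace := by
    rw [trace_mul_comm, ← mul_assoc, hUU', one_mul]
  rw [ht, trace, Complex.re_sum]
  refine Finset.sum_le_sum fun i _ => ?_
  have e1 : 0 ≤ (Uᴴ * G * U) i i :=
    ((nonneg_iff_posSemidef.1 hG).conjTranspose_mul_mul_same U).diag_nonneg
  have e2 : 0 ≤ (Uᴴ * (G - (H - c • (1 : Matrix (Fin n) (Fin n) ℂ))) * U) i i :=
    ((le_iff.1 hHG).conjTranspose_mul_mul_same U).diag_nonneg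
  have e3 : Uᴴ * (G - (H - c • (1 : Matrix (Fin n) (Fin n) ℂ))) * U =
      Uᴴ * G * U - (diagonal (fun i => (hH.eigenvalues i : ℂ)) - c • 1) := by
    rw [← hd, ← hUU]
    simp only [mul_sub, sub_mul, mul_smul_comm, smul_mul_assoc, mul_one, hUU]
  rw [e3] at e2
  have e2' := (Complex.le_def.1 e2).1
  have e1' := (Complex.le_def.1 e1).1
  simp at e1' e2'
  simp only [diag_apply]
  exact max_le (by linarith) e1'

lemma rpow_hinge {p x M : ℝ} (hp : 1 < p) (hxM : x ≤ M) (hM : 0 ≤ M) :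
    IntervalIntegrable (fun c : ℝ => c ^ (p - 2) * max (x - c) 0) MeasureTheory.volume 0 M ∧
    (max x 0) ^ p = p * (p - 1) * ∫ c in (0 : ℝ)..M, c ^ (p - 2) * max (x - c) 0 := by
  have hI : ∀ a b : ℝ, IntervalIntegrable (fun c : ℝ => c ^ (p - 2) * max (x - c) 0)
      MeasureTheory.volume a b := fun a b =>
    (intervalIntegral.intervalIntegrable_rpow' (by linarith)).mul_continuousOn
      (by fun_prop)
  refine ⟨hI _ _, ?_⟩
  rcases le_total x 0 with hx | hx
  · rw [max_eq_right hx, Real.zero_rpow (by linarith),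
      intervalIntegral.integral_congr (g := fun _ => 0)]
    · simp
    · intro c hc
      rw [Set.uIcc_of_le hM] at hc
      simp only
      rw [max_eq_right (by linarith [hc.1]), mul_zero]
  · rw [← intervalIntegral.integral_add_adjacent_intervals (hI 0 x) (hI x M)]
    have h2 : ∫ c in x..M, c ^ (p - 2) * max (x - c) 0 = 0 := by
      rw [intervalIntegral.integral_congr (g := fun _ => 0)]
      · simp
      · intro c hc
        rw [Set.uIcc_of_le hxM] at hc
        simp only
        rw [max_eq_right (by linarith [hc.1]), mul_zero]
    have h1 : ∫ c in (0 : ℝ)..x, c ^ (p - 2) * max (x - c) 0 =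
        ∫ c in (0 : ℝ)..x, (x * c ^ (p - 2) - c ^ (p - 1)) := by
      refine intervalIntegral.integral_congr fun c hc => ?_
      rw [Set.uIcc_of_le hx] at hc
      rw [max_eq_left (by linarith [hc.2])]
      rcases hc.1.eq_or_lt with h0 | h0
      · subst h0
        rw [Real.zero_rpow (x := p - 1) (by linarith)]
        ring
      · have : c ^ (p - 1) = c ^ (p - 2) * c := by
          rw [← Real.rpow_add_one h0.ne']; congr 1; ring
        rw [this]; ring
    rw [h2, h1, intervalIntegral.integral_sub, intervalIntegral.integral_const_mul,
      integral_rpow (Or.inl (by linarith)), integral_rpow (Or.inl (by linarith)),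
      max_eq_left hx, Real.zero_rpow (by linarith), Real.zero_rpow (by linarith)]
    · rcases hx.eq_or_lt with h0 | h0
      · subst h0
        simp [Real.zero_rpow (show p ≠ 0 by linarith)]
      · have e1 : p - 2 + 1 = p - 1 := by ring
        have e2 : p - 1 + 1 = p := by ring
        have : x ^ p = x ^ (p - 1) * x := by
          rw [← Real.rpow_add_one h0.ne', e2]
        rw [e1, e2, this]
        have : p ≠ 0 := by linarith
        have : p - 1 ≠ 0 := by linarith
        field_simp
        ring
    · exact (intervalIntegral.intervalIntegrable_rpow' (by linarith)).const_mul _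
    · exact intervalIntegral.intervalIntegrable_rpow' (by linarith)

lemma maj_pos {p : ℝ} (hp : 1 ≤ p) (a b : Fin n → ℝ)
    (h : ∀ c, 0 ≤ c → ∑ i, max (a i - c) 0 ≤ ∑ i, max (b i - c) 0) :
    ∑ i, (max (a i) 0) ^ p ≤ ∑ i, (max (b i) 0) ^ p := by
  rcases hp.eq_or_lt with h1 | h1
  · subst h1
    simpa using h 0 le_rfl
  · obtain ⟨M, hM0, hMa, hMb⟩ : ∃ M : ℝ, 0 ≤ M ∧ (∀ i, a i ≤ M) ∧ ∀ i, b i ≤ M := by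
      refine ⟨∑ i, |a i| + ∑ i, |b i|, by positivity, fun i => ?_, fun i => ?_⟩
      · have := Finset.single_le_sum (f := fun i => |a i|) (fun i _ => abs_nonneg _)
          (Finset.mem_univ i)
        have h2 : 0 ≤ ∑ i, |b i| := by positivity
        have := le_abs_self (a i)
        linarith
      · have := Finset.single_le_sum (f := fun i => |b i|) (fun i _ => abs_nonneg _)
          (Finset.mem_univ i)
        have h2 : 0 ≤ ∑ i, |a i| := by positivity
        have := le_abs_self (b i)
        linarith
    have key : ∀ x : Fin n → ℝ, (∀ i, x i ≤ M) →
        IntervalIntegrable (fun c : ℝ => c ^ (p - 2) * ∑ i, max (x i - c) 0)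
          MeasureTheory.volume 0 M ∧
        ∑ i, (max (x i) 0) ^ p = p * (p - 1) *
          ∫ c in (0 : ℝ)..M, c ^ (p - 2) * ∑ i, max (x i - c) 0 := by
      intro x hx
      simp only [Finset.mul_sum]
      constructor
      · have := IntervalIntegrable.sum (μ := MeasureTheory.volume) Finset.univ
          (f := fun i => fun c : ℝ => c ^ (p - 2) * max (x i - c) 0) (a := 0) (b := M)
          (fun i _ => (rpow_hinge h1 (hx i) hM0).1)
        have he : (fun c : ℝ => ∑ i, c ^ (p - 2) * max (x i - c) 0) =
            ∑ i, (fun c : ℝ => c ^ (p - 2) * max (x i - c) 0) := by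
          ext c
          simp
        rw [he]
        exact this
      · rw [intervalIntegral.integral_finsetSum
          (fun i _ => (rpow_hinge h1 (hx i) hM0).1), Finset.mul_sum]
        exact Finset.sum_congr rfl fun i _ => (rpow_hinge h1 (hx i) hM0).2
    rw [(key a hMa).2, (key b hMb).2]
    refine mul_le_mul_of_nonneg_left ?_ (mul_nonneg (by linarith) (by linarith))
    refine intervalIntegral.integral_mono_on hM0 (key a hMa).1 (key b hMb).1 fun c hc => ?_
    exact mul_le_mul_of_nonneg_left (h c hc.1) (Real.rpow_nonneg hc.1 _)

lemma abs_split {p : ℝ} (hp : 1 ≤ p) (x : ℝ) :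
    |x| ^ p = (max x 0) ^ p + (max (-x) 0) ^ p := by
  have hp0 : p ≠ 0 := by linarith
  rcases le_total 0 x with h | h
  · rw [abs_of_nonneg h, max_eq_left h, max_eq_right (by linarith), Real.zero_rpow hp0, add_zero]
  · rw [abs_of_nonpos h, max_eq_right h, max_eq_left (by linarith), Real.zero_rpow hp0, zero_add]

lemma maj_abs {p : ℝ} (hp : 1 ≤ p) (a b : Fin n → ℝ) (hs : ∑ i, a i = ∑ i, b i)
    (h : ∀ c : ℝ, ∑ i, max (a i - c) 0 ≤ ∑ i, max (b i - c) 0) :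
    ∑ i, |a i| ^ p ≤ ∑ i, |b i| ^ p := by
  simp only [abs_split hp, Finset.sum_add_distrib]
  refine add_le_add (maj_pos hp a b fun c _ => h c)
    (maj_pos hp (fun i => -a i) (fun i => -b i) fun c _ => ?_)
  have e : ∀ x : ℝ, max (-x - c) 0 = max (x - (-c)) 0 - x - c := by
    intro x
    rcases le_total (-x - c) 0 with h | h
    · rw [max_eq_right h, max_eq_left (by linarith)]; ring
    · rw [max_eq_left h, max_eq_right (by linarith)]; ring
  simp only [e, Finset.sum_sub_distrib, hs]
  linarith [h (-c)]

lemma main_ineq {p : ℝ} (hp : 1 ≤ p) {A B : Matrix (Fin n) (Fin n) ℂ}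
    (hA : A.PosDef) (hB : B.PosDef) :
    schattenNorm p (matLog A - matLog B) ≤ dMab p A B := by
  have hsA : IsSelfAdjoint A := hA.isHermitian
  have hpos : ∀ x ∈ spectrum ℝ A, 0 < x := by
    intro x hx
    rw [hA.isHermitian.spectrum_real_eq_range_eigenvalues] at hx
    obtain ⟨i, rfl⟩ := hx
    exact hA.eigenvalues_pos i
  set R := matInvSqrt A with hR
  set S : Matrix (Fin n) (Fin n) ℂ := cfc Real.sqrt A with hS
  have hRs : Rᴴ = R := (cfc_predicate _ A : IsSelfAdjoint R)
  have hSs : Sᴴ = S := (cfc_predicate _ A : IsSelfAdjoint S)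
  have hSR : S * R = 1 := by
    rw [hS, hR, matInvSqrt, ← cfc_mul _ _ A (contS _ _) (contS _ _), ← cfc_one ℝ A hsA]
    refine cfc_congr fun x hx => ?_
    exact mul_inv_cancel₀ (Real.sqrt_ne_zero'.2 (hpos x hx))
  have hRS : R * S = 1 := mul_eq_one_comm.1 hSR
  have hSS : S * S = A := by
    rw [hS, ← cfc_mul _ _ A (contS _ _) (contS _ _)]
    conv_rhs => rw [← cfc_id ℝ A hsA]
    refine cfc_congr fun x hx => ?_
    exact Real.mul_self_sqrt (hpos x hx).le
  have hRu : IsUnit R := ⟨⟨R, S, hRS, hSR⟩, rfl⟩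
  have hSu : IsUnit S := ⟨⟨S, R, hSR, hRS⟩, rfl⟩
  set M := R * B * R with hMdef
  have hM : M.PosDef := by
    have := hB.conjTranspose_mul_mul_same (B := R) (mulVec_injective_iff_isUnit.2 hRu)
    rwa [hRs] at this
  have hMs : IsSelfAdjoint M := hM.isHermitian
  have hSMS : S * M * S = B := by
    rw [hMdef]
    calc S * (R * B * R) * S = (S * R) * B * (R * S) := by simp only [mul_assoc]
      _ = B := by rw [hSR, hRS, one_mul, mul_one]
  have hH : (matLog B - matLog A).IsHermitian :=
    IsSelfAdjoint.sub (cfc_predicate _ B : IsSelfAdjoint (matLog B))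
      (cfc_predicate _ A : IsSelfAdjoint (matLog A))
  set μ := hM.isHermitian.eigenvalues with hμ
  have hμpos : ∀ i, 0 < μ i := hM.eigenvalues_pos
  -- traces
  have hdetA : 0 < A.det.re := (Complex.pos_iff.1 hA.det_pos).1
  have htr : ∀ f : ℝ → ℝ, (∀ i, 0 < f (μ i)) → (S * cfc f M * S).PosDef →
      (matLog (S * cfc f M * S)).trace =
        (matLog A).trace + ((∑ i, Real.log (f (μ i)) : ℝ) : ℂ) := by
    intro f hf hC
    have hd : (S * cfc f M * S).det = A.det * ((∏ i, f (μ i) : ℝ) : ℂ) := by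
      rw [← hSS, det_mul, det_mul, det_mul, det_cfc hM.isHermitian]
      ring
    rw [trace_log hC, trace_log hA, hd, Complex.re_mul_ofReal, Real.log_mul hdetA.ne'
      (Finset.prod_pos fun i _ => hf i).ne', Real.log_prod (fun i _ => (hf i).ne')]
    push_cast
    rfl
  have htrB : (matLog B).trace = (matLog A).trace + ((∑ i, Real.log (μ i) : ℝ) : ℂ) := by
    have hid : cfc (fun x : ℝ => x) M = M := cfc_id' ℝ M hMs
    have := htr (fun x => x) hμpos (by rw [hid, hSMS]; exact hB)
    rwa [hid, hSMS] at this
  have hsum : ∑ i, hH.eigenvalues i = ∑ i, Real.log (μ i) := by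
    have h1 := hH.trace_eq_sum_eigenvalues
    rw [trace_sub, htrB, add_sub_cancel_left] at h1
    have h2 := congrArg Complex.re h1
    simp at h2
    rw [h2]
  have hinge : ∀ c : ℝ, ∑ i, max (hH.eigenvalues i - c) 0 ≤
      ∑ i, max (Real.log (μ i) - c) 0 := by
    intro c
    set f : ℝ → ℝ := fun t => max t (Real.exp c) with hf
    have hconj : ∀ X Y : Matrix (Fin n) (Fin n) ℂ, X ≤ Y → S * X * S ≤ S * Y * S := by
      intro X Y hXY
      have := (le_iff.1 hXY).conjTranspose_mul_mul_same S
      rw [hSs] at this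
      rw [le_iff]
      convert this using 1
      rw [mul_sub, sub_mul]
    have l1 : B ≤ S * cfc f M * S := by
      rw [← hSMS]
      refine hconj _ _ ?_
      conv_lhs => rw [← cfc_id' ℝ M hMs]
      exact cfc_mono (fun x _ => le_max_left _ _) (contS _ _) (contS _ _)
    have l2 : Real.exp c • A ≤ S * cfc f M * S := by
      have : Real.exp c • A = S * (Real.exp c • 1) * S := by
        rw [mul_smul_comm, smul_mul_assoc, mul_one, hSS]
      rw [this]
      refine hconj _ _ ?_
      rw [← Algebra.algebraMap_eq_smul_one, ← cfc_const (Real.exp c) M hMs]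
      exact cfc_mono (fun x _ => le_max_right _ _) (contS _ _) (contS _ _)
    have hCpos : (S * cfc f M * S).PosDef := by
      have : S * cfc f M * S = B + (S * cfc f M * S - B) := by abel
      rw [this]
      exact hB.add_posSemidef (le_iff.1 l1)
    have hEA : (Real.exp c • A).PosDef := hA.smul (Real.exp_pos c)
    have g1 := matLog_le hB l1
    have g2 := matLog_le hEA l2
    rw [matLog_smul hA] at g2
    have key := hinge_trace hH c
      (G := matLog (S * cfc f M * S) - (c • (1 : Matrix (Fin n) (Fin n) ℂ) + matLog A))
      (sub_nonneg.2 g2) (by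
        have : matLog B - matLog A - c • (1 : Matrix (Fin n) (Fin n) ℂ) =
          matLog B - (c • (1 : Matrix (Fin n) (Fin n) ℂ) + matLog A) := by abel
        rw [this]
        exact sub_le_sub_right g1 _)
    refine key.trans (le_of_eq ?_)
    rw [trace_sub, trace_add, htr f (fun i => lt_max_of_lt_left (hμpos i)) hCpos, trace_smul,
      trace_one]
    have e : ∀ i, Real.log (f (μ i)) = max (Real.log (μ i) - c) 0 + c := by
      intro i
      simp only [hf]
      rcases le_total (μ i) (Real.exp c) with h | h
      · have := Real.log_le_log (hμpos i) h
        rw [Real.log_exp] at this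
        rw [max_eq_right h, Real.log_exp, max_eq_right (by linarith), zero_add]
      · have := Real.log_le_log (Real.exp_pos c) h
        rw [Real.log_exp] at this
        rw [max_eq_left h, max_eq_left (by linarith)]
        ring
    simp only [e, Finset.sum_add_distrib]
    simp
    ring
  have hfin := maj_abs hp _ _ hsum hinge
  have e1 : schattenNorm p (matLog A - matLog B) = schattenNorm p (matLog B - matLog A) := by
    rw [schattenNorm, schattenNorm, ← neg_sub (matLog B), conjTranspose_neg, neg_mul_neg]
  have e2 : cfc (fun x : ℝ => x) (matLog B - matLog A) = matLog B - matLog A := cfc_id' ℝ _ hH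
  rw [e1, ← e2, trace_schatten hH, dMab, ← hR, ← hMdef]
  change _ ≤ schattenNorm p (cfc Real.log M)
  rw [trace_schatten hM.isHermitian]
  refine Real.rpow_le_rpow ?_ ?_ (by positivity)
  · positivity
  · exact mul_le_mul_of_nonneg_left hfin (by positivity)

end SLog

/-- If two sequences of positive definite Hermitian matrices satisfy
`d_p(A_k, B_k)/k → 0`, then `‖log A_k − log B_k‖_p/k → 0`: for every `ε > 0` there is
`k₀` with `‖log A_k − log B_k‖_p ≤ ε k` for all `k ≥ k₀`. -/
theorem schatten_log_of_dp_sublinear (p : ℝ) (hp : 1 ≤ p)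
    (n : ℕ → ℕ) (hn : ∀ k, 0 < n k)
    (A B : ∀ k : ℕ, Matrix (Fin (n k)) (Fin (n k)) ℂ)
    (hA : ∀ k, (A k).PosDef) (hB : ∀ k, (B k).PosDef)
    (h : Tendsto (fun k : ℕ => dMab p (A k) (B k) / k) atTop (nhds 0)) :
    ∀ ε > (0 : ℝ), ∃ k₀ : ℕ, ∀ k ≥ k₀,
      schattenNorm p (matLog (A k) - matLog (B k)) ≤ ε * k := by
  intro ε hε
  obtain ⟨k₀, hk₀⟩ := eventually_atTop.1 ((h.eventually (gt_mem_nhds hε)).and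
    (eventually_gt_atTop 0))
  refine ⟨k₀, fun k hk => (SLog.main_ineq hp (hA k) (hB k)).trans ?_⟩
  obtain ⟨h1, h2⟩ := hk₀ k hk
  have h2' : (0 : ℝ) < k := by exact_mod_cast h2
  exact ((div_lt_iff₀ h2').1 h1).le
end
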